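/- An unsatisfiable acyclic infinite timely constraint: let I = ℕ (positive integers) and define δ(1,n) = −n for every n ∈ ℕ with n ≠ 1, and δ(i,j) = +∞ for all other pairs of distinct i, j. Then δ is unsatisfiable, even though G_δ contains no negative cycles (indeed no cycles at all). -/

import Mathlib

noncomputable section

/-- `D ≤ ℝ` (an additive subgroup) is closed under infima of nonempty
bounded-below subsets. -/
def ClosedUnderInf (D : AddSubgroup ℝ) : Prop :=
  ∀ S : Set ℝ, S.Nonempty → BddBelow S → S ⊆ (D : Set ℝ) → sInf S ∈ D

/-- A timely constraint on `I`: on every pair of distinct actions, `δ` takes a value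
in `Δ = D ∪ {-∞, +∞}`, viewed inside the extended reals. -/
def IsTimelyConstraint (D : AddSubgroup ℝ) {I : Type*} (δ : I → I → EReal) : Prop :=
  ∀ i j : I, i ≠ j → δ i j = ⊤ ∨ δ i j = ⊥ ∨ ∃ d : ℝ, d ∈ D ∧ δ i j = (d : EReal)

/-- `t : I → ℝ` takes values in `𝕋` (the nonnegative part of `D`) and satisfies the
timely constraint `δ`, i.e. `t j ≤ t i + δ i j` for all distinct `i, j`. -/
def Satisfies (D : AddSubgroup ℝ) {I : Type*} (δ : I → I → EReal) (t : I → ℝ) : Prop :=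
  (∀ i, t i ∈ D) ∧ (∀ i, 0 ≤ t i) ∧
    ∀ i j : I, i ≠ j → (t j : EReal) ≤ (t i : EReal) + δ i j

/-- A path in the graph `G_δ`: a nonempty finite sequence of vertices, each consecutive
pair being an edge, i.e. a pair of distinct vertices with `δ < ∞`. -/
def IsPath {I : Type*} (δ : I → I → EReal) (p : List I) : Prop :=
  p ≠ [] ∧ p.Chain' fun a b => a ≠ b ∧ δ a b < ⊤

/-- The length of a path: the sum of the weights of its edges. -/
def pathLength {I : Type*} (δ : I → I → EReal) (p : List I) : EReal :=
  ((p.zip p.tail).map fun q => δ q.1 q.2).sum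

/-- The canonical form `δ̂` of `δ`: the distance function of `G_δ`, i.e. the infimum in
the extended reals of the lengths of all paths from `i` to `j` (`+∞` if there is none). -/
def canon {I : Type*} (δ : I → I → EReal) (i j : I) : EReal :=
  sInf {L : EReal | ∃ p : List I,
    IsPath δ p ∧ p.head? = some i ∧ p.getLast? = some j ∧ pathLength δ p = L}

/-- A negative cycle in `G_δ`: a path with at least two entries, whose first and last
vertices coincide, of negative length. -/
def IsNegativeCycle {I : Type*} (δ : I → I → EReal) (p : List I) : Prop :=
  IsPath δ p ∧ 2 ≤ p.length ∧ p.head? = p.getLast? ∧ pathLength δ p < 0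

/-- If every edge of `G_δ` starts at `r`, then `G_δ` has no cycles. -/
theorem not_isPath_cycle_of_eq_top {I : Type*} {δ : I → I → EReal} {r : I}
    (h : ∀ i j : I, i ≠ j → i ≠ r → δ i j = ⊤) :
    ¬∃ p : List I, IsPath δ p ∧ 2 ≤ p.length ∧ p.head? = p.getLast? := by
  have source_eq {i j : I} (hij : i ≠ j ∧ δ i j < ⊤) : i = r := by
    by_contra hi
    exact hij.2.ne (h i j hij.1 hi)
  rintro ⟨p, ⟨-, hchain⟩, hlen, hends⟩
  match p, hchain, hlen, hends with
  | [a, b], hchain, _, hends =>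
    have hab : a ≠ b ∧ δ a b < ⊤ := (List.isChain_cons_cons.1 hchain).1
    exact hab.1 (by simpa using hends)
  | a :: b :: c :: l, hchain, _, _ =>
    obtain ⟨hab, hbc⟩ := List.isChain_cons_cons.1 hchain
    have hbc := (List.isChain_cons_cons.1 hbc).1
    exact hab.1 ((source_eq hab).trans (source_eq hbc).symm)

/-- An unsatisfiable acyclic infinite timely constraint: on `I = ℕ⁺` with
`δ(1,n) = -n` for `n ≠ 1` and `δ = +∞` elsewhere (here `D = ℝ`), `δ` is unsatisfiable
even though `G_δ` contains no negative cycles — indeed no cycles at all. -/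
theorem unsatisfiable_acyclic_example (δ : ℕ+ → ℕ+ → EReal)
    (h1 : ∀ n : ℕ+, n ≠ 1 → δ 1 n = ((-(n : ℕ) : ℝ) : EReal))
    (h2 : ∀ i j : ℕ+, i ≠ j → i ≠ 1 → δ i j = ⊤) :
    (¬∃ t : ℕ+ → ℝ, Satisfies (⊤ : AddSubgroup ℝ) δ t) ∧
      (¬∃ p : List ℕ+, IsNegativeCycle δ p) ∧
      (¬∃ p : List ℕ+, IsPath δ p ∧ 2 ≤ p.length ∧ p.head? = p.getLast?) := by
  refine ⟨?_, ?_, not_isPath_cycle_of_eq_top h2⟩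
  · rintro ⟨t, -, ht0, ht⟩
    obtain ⟨m, hm⟩ := exists_nat_gt (t 1)
    have hm0 : 0 < m := by exact_mod_cast (ht0 1).trans_lt hm
    let n : ℕ+ := ⟨m + 1, m.succ_pos⟩
    have hn : n ≠ 1 := fun h => hm0.ne' (by simpa [n] using congrArg PNat.val h)
    have hle := ht 1 n hn.symm
    rw [h1 n hn, ← EReal.coe_add, EReal.coe_le_coe_iff] at hle
    have hcast : ((n : ℕ) : ℝ) = m + 1 := by simp [n]
    linarith [ht0 n]
  · rintro ⟨p, hp, hlen, hends, -⟩
    exact not_isPath_cycle_of_eq_top h2 ⟨p, hp, hlen, hends⟩
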